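/- Let (H, μ, Δ, α_H) be a Hom-bialgebra with α_H bijective, and let (M, α_M), (N, α_N), (P, α_P) be Yetter-Drinfeld modules over H with α_M, α_N, α_P bijective. Define a_{M,N,P}: (M⊗̂N)⊗̂P → M⊗̂(N⊗̂P) by a_{M,N,P}((m⊗n)⊗p) = α_M^{-1}(m) ⊗ (n ⊗ α_P(p)). Then a_{M,N,P} is bijective, satisfies (α_M⊗α_N⊗α_P)∘a_{M,N,P} = a_{M,N,P}∘(α_M⊗α_N⊗α_P), is H-linear (a_{M,N,P}(h·x) = h·a_{M,N,P}(x) with respect to the iterated ⊗̂ actions) and is H-colinear ((id_H⊗a_{M,N,P})∘λ_{(M⊗̂N)⊗̂P} = λ_{M⊗̂(N⊗̂P)}∘a_{M,N,P} with respect to the iterated ⊗̂ coactions). -/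

import Mathlib

open TensorProduct

noncomputable section

namespace HomYD

variable (k : Type*) [Field k]
variable {H M N : Type*}
variable [AddCommGroup H] [Module k H]
variable [AddCommGroup M] [Module k M]
variable [AddCommGroup N] [Module k N]

/-- Rearrangement `(a ⊗ b) ⊗ c ↦ (a ⊗ c) ⊗ b`. -/
def rearr (A B C : Type*) [AddCommGroup A] [Module k A] [AddCommGroup B] [Module k B]
    [AddCommGroup C] [Module k C] :
    (A ⊗[k] B) ⊗[k] C →ₗ[k] (A ⊗[k] C) ⊗[k] B :=
  (TensorProduct.assoc k A C B).symm.toLinearMap ∘ₗ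
    (TensorProduct.map LinearMap.id (TensorProduct.comm k B C).toLinearMap) ∘ₗ
      (TensorProduct.assoc k A B C).toLinearMap

/-- Middle-four exchange `(a ⊗ b) ⊗ (c ⊗ d) ↦ (a ⊗ c) ⊗ (b ⊗ d)`. -/
def ttc (A B C D : Type*) [AddCommGroup A] [Module k A] [AddCommGroup B] [Module k B]
    [AddCommGroup C] [Module k C] [AddCommGroup D] [Module k D] :
    (A ⊗[k] B) ⊗[k] (C ⊗[k] D) →ₗ[k] (A ⊗[k] C) ⊗[k] (B ⊗[k] D) :=
  (TensorProduct.tensorTensorTensorComm k A B C D).toLinearMap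

/-- Hom-bialgebra (no unit/counit): multiplicativity of `α`, Hom-associativity,
comultiplicativity of `α`, Hom-coassociativity, and `Δ` multiplicative. -/
structure IsHomBialgebra (μ : H ⊗[k] H →ₗ[k] H) (Δ : H →ₗ[k] H ⊗[k] H)
    (α : H →ₗ[k] H) : Prop where
  mul_mult : ∀ a b : H, α (μ (a ⊗ₜ[k] b)) = μ (α a ⊗ₜ[k] α b)
  hom_assoc : ∀ a b c : H, μ (α a ⊗ₜ[k] μ (b ⊗ₜ[k] c)) = μ (μ (a ⊗ₜ[k] b) ⊗ₜ[k] α c)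
  comul_compat : TensorProduct.map α α ∘ₗ Δ = Δ ∘ₗ α
  hom_coassoc : (TensorProduct.assoc k H H H).toLinearMap ∘ₗ TensorProduct.map Δ α ∘ₗ Δ
      = TensorProduct.map α Δ ∘ₗ Δ
  comul_mul : Δ ∘ₗ μ
      = TensorProduct.map μ μ ∘ₗ ttc k H H H H ∘ₗ TensorProduct.map Δ Δ

/-- Left module over a Hom-(bi)algebra. -/
structure IsHomModule (μ : H ⊗[k] H →ₗ[k] H) (α : H →ₗ[k] H)
    (ρ : H ⊗[k] M →ₗ[k] M) (αM : M →ₗ[k] M) : Prop where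
  str_compat : ∀ (h : H) (m : M), αM (ρ (h ⊗ₜ[k] m)) = ρ (α h ⊗ₜ[k] αM m)
  hom_smul : ∀ (h h' : H) (m : M),
      ρ (α h ⊗ₜ[k] ρ (h' ⊗ₜ[k] m)) = ρ (μ (h ⊗ₜ[k] h') ⊗ₜ[k] αM m)

/-- Left comodule over a Hom-(bi)algebra. -/
structure IsHomComodule (Δ : H →ₗ[k] H ⊗[k] H) (α : H →ₗ[k] H)
    (lM : M →ₗ[k] H ⊗[k] M) (αM : M →ₗ[k] M) : Prop where
  str_compat : TensorProduct.map α αM ∘ₗ lM = lM ∘ₗ αM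
  hom_coact : TensorProduct.map Δ αM ∘ₗ lM
      = (TensorProduct.assoc k H H M).symm.toLinearMap ∘ₗ TensorProduct.map α lM ∘ₗ lM

/-- `h ⊗ m ↦ (h₁·m)₍₋₁₎ β(h₂) ⊗ (h₁·m)₍₀₎`. -/
def ydL (μ : H ⊗[k] H →ₗ[k] H) (Δ : H →ₗ[k] H ⊗[k] H) (β : H →ₗ[k] H)
    (ρ : H ⊗[k] M →ₗ[k] M) (lM : M →ₗ[k] H ⊗[k] M) : H ⊗[k] M →ₗ[k] H ⊗[k] M :=
  TensorProduct.map μ LinearMap.id ∘ₗ rearr k H M H ∘ₗ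
    TensorProduct.map (lM ∘ₗ ρ) β ∘ₗ rearr k H H M ∘ₗ
      TensorProduct.map Δ LinearMap.id

/-- `h ⊗ m ↦ β(h₁) γ(m₍₋₁₎) ⊗ γ(h₂)·m₍₀₎`. -/
def ydR (μ : H ⊗[k] H →ₗ[k] H) (Δ : H →ₗ[k] H ⊗[k] H) (β γ : H →ₗ[k] H)
    (ρ : H ⊗[k] M →ₗ[k] M) (lM : M →ₗ[k] H ⊗[k] M) : H ⊗[k] M →ₗ[k] H ⊗[k] M :=
  TensorProduct.map (μ ∘ₗ TensorProduct.map β γ) (ρ ∘ₗ TensorProduct.map γ LinearMap.id) ∘ₗ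
    ttc k H H H M ∘ₗ TensorProduct.map Δ lM

/-- Yetter-Drinfeld module over a Hom-bialgebra: Hom-module, Hom-comodule and the
compatibility `(h₁·m)₍₋₁₎ α²(h₂) ⊗ (h₁·m)₍₀₎ = α²(h₁) α(m₍₋₁₎) ⊗ α(h₂)·m₍₀₎`. -/
def IsYetterDrinfeld (μ : H ⊗[k] H →ₗ[k] H) (Δ : H →ₗ[k] H ⊗[k] H) (α : H →ₗ[k] H)
    (ρ : H ⊗[k] M →ₗ[k] M) (lM : M →ₗ[k] H ⊗[k] M) (αM : M →ₗ[k] M) : Prop :=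
  IsHomModule k μ α ρ αM ∧ IsHomComodule k Δ α lM αM ∧
    ydL k μ Δ (α ∘ₗ α) ρ lM = ydR k μ Δ (α ∘ₗ α) α ρ lM

/-- `m ⊗ n ↦ αHinv(m₍₋₁₎)·n ⊗ m₍₀₎`. -/
def Bmap (αHinv : H →ₗ[k] H) (lM : M →ₗ[k] H ⊗[k] M) (ρN : H ⊗[k] N →ₗ[k] N) :
    M ⊗[k] N →ₗ[k] N ⊗[k] M :=
  TensorProduct.map (ρN ∘ₗ TensorProduct.map αHinv LinearMap.id) LinearMap.id ∘ₗ
    rearr k H M N ∘ₗ TensorProduct.map lM LinearMap.id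

/-- Quasi-braiding `m ⊗ n ↦ αN⁻¹(αH⁻¹(m₍₋₁₎)·n) ⊗ αM⁻¹(m₍₀₎)`. -/
def braidYD (αH : H ≃ₗ[k] H) (αM : M ≃ₗ[k] M) (αN : N ≃ₗ[k] N)
    (lM : M →ₗ[k] H ⊗[k] M) (ρN : H ⊗[k] N →ₗ[k] N) : M ⊗[k] N →ₗ[k] N ⊗[k] M :=
  TensorProduct.map
      (αN.symm.toLinearMap ∘ₗ ρN ∘ₗ TensorProduct.map αH.symm.toLinearMap LinearMap.id)
      αM.symm.toLinearMap ∘ₗ rearr k H M N ∘ₗ TensorProduct.map lM LinearMap.id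

/-- Action on `M ⊗ N`: `h ⊗ (m ⊗ n) ↦ h₁·m ⊗ h₂·n`. -/
def hatAction (Δ : H →ₗ[k] H ⊗[k] H)
    (ρM : H ⊗[k] M →ₗ[k] M) (ρN : H ⊗[k] N →ₗ[k] N) :
    H ⊗[k] (M ⊗[k] N) →ₗ[k] M ⊗[k] N :=
  TensorProduct.map ρM ρN ∘ₗ ttc k H H M N ∘ₗ TensorProduct.map Δ LinearMap.id

/-- Coaction on `M ⊗ N`: `m ⊗ n ↦ αHinv²(m₍₋₁₎ n₍₋₁₎) ⊗ (m₍₀₎ ⊗ n₍₀₎)`. -/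
def hatCoaction (μ : H ⊗[k] H →ₗ[k] H) (αHinv : H →ₗ[k] H)
    (lM : M →ₗ[k] H ⊗[k] M) (lN : N →ₗ[k] H ⊗[k] N) :
    M ⊗[k] N →ₗ[k] H ⊗[k] (M ⊗[k] N) :=
  TensorProduct.map (αHinv ∘ₗ αHinv ∘ₗ μ) LinearMap.id ∘ₗ ttc k H M H N ∘ₗ
    TensorProduct.map lM lN

/-- Action on `M ⊗ N`: `h ⊗ (m ⊗ n) ↦ αHinv²(h₁)·m ⊗ αHinv²(h₂)·n`. -/
def tildeAction (Δ : H →ₗ[k] H ⊗[k] H) (αHinv : H →ₗ[k] H)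
    (ρM : H ⊗[k] M →ₗ[k] M) (ρN : H ⊗[k] N →ₗ[k] N) :
    H ⊗[k] (M ⊗[k] N) →ₗ[k] M ⊗[k] N :=
  TensorProduct.map ρM ρN ∘ₗ ttc k H H M N ∘ₗ
    TensorProduct.map
      (TensorProduct.map (αHinv ∘ₗ αHinv) (αHinv ∘ₗ αHinv) ∘ₗ Δ) LinearMap.id

/-- Coaction on `M ⊗ N`: `m ⊗ n ↦ m₍₋₁₎ n₍₋₁₎ ⊗ (m₍₀₎ ⊗ n₍₀₎)`. -/
def tildeCoaction (μ : H ⊗[k] H →ₗ[k] H)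
    (lM : M →ₗ[k] H ⊗[k] M) (lN : N →ₗ[k] H ⊗[k] N) :
    M ⊗[k] N →ₗ[k] H ⊗[k] (M ⊗[k] N) :=
  TensorProduct.map μ LinearMap.id ∘ₗ ttc k H M H N ∘ₗ TensorProduct.map lM lN

/-- Associator `(x ⊗ y) ⊗ z ↦ αX⁻¹(x) ⊗ (y ⊗ αZ(z))`. -/
def aYD {X Z : Type*} [AddCommGroup X] [Module k X] [AddCommGroup Z] [Module k Z]
    (αX : X ≃ₗ[k] X) (Y : Type*) [AddCommGroup Y] [Module k Y] (αZ : Z ≃ₗ[k] Z) :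
    (X ⊗[k] Y) ⊗[k] Z →ₗ[k] X ⊗[k] (Y ⊗[k] Z) :=
  (TensorProduct.assoc k X Y Z).toLinearMap ∘ₗ
    TensorProduct.map (TensorProduct.map αX.symm.toLinearMap LinearMap.id) αZ.toLinearMap

/-- Inverse associator `x ⊗ (y ⊗ z) ↦ (αX(x) ⊗ y) ⊗ αZ⁻¹(z)`. -/
def aYDinv {X Z : Type*} [AddCommGroup X] [Module k X] [AddCommGroup Z] [Module k Z]
    (αX : X ≃ₗ[k] X) (Y : Type*) [AddCommGroup Y] [Module k Y] (αZ : Z ≃ₗ[k] Z) :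
    X ⊗[k] (Y ⊗[k] Z) →ₗ[k] (X ⊗[k] Y) ⊗[k] Z :=
  TensorProduct.map (TensorProduct.map αX.toLinearMap LinearMap.id) αZ.symm.toLinearMap ∘ₗ
    (TensorProduct.assoc k X Y Z).symm.toLinearMap

/-- Associator `(x ⊗ y) ⊗ z ↦ αX(x) ⊗ (y ⊗ αZ⁻¹(z))`. -/
def aTilde {X Z : Type*} [AddCommGroup X] [Module k X] [AddCommGroup Z] [Module k Z]
    (αX : X ≃ₗ[k] X) (Y : Type*) [AddCommGroup Y] [Module k Y] (αZ : Z ≃ₗ[k] Z) :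
    (X ⊗[k] Y) ⊗[k] Z →ₗ[k] X ⊗[k] (Y ⊗[k] Z) :=
  (TensorProduct.assoc k X Y Z).toLinearMap ∘ₗ
    TensorProduct.map (TensorProduct.map αX.toLinearMap LinearMap.id) αZ.symm.toLinearMap

/-- Inverse associator `x ⊗ (y ⊗ z) ↦ (αX⁻¹(x) ⊗ y) ⊗ αZ(z)`. -/
def aTildeInv {X Z : Type*} [AddCommGroup X] [Module k X] [AddCommGroup Z] [Module k Z]
    (αX : X ≃ₗ[k] X) (Y : Type*) [AddCommGroup Y] [Module k Y] (αZ : Z ≃ₗ[k] Z) :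
    X ⊗[k] (Y ⊗[k] Z) →ₗ[k] (X ⊗[k] Y) ⊗[k] Z :=
  TensorProduct.map (TensorProduct.map αX.symm.toLinearMap LinearMap.id) αZ.toLinearMap ∘ₗ
    (TensorProduct.assoc k X Y Z).symm.toLinearMap

/-- Quasitriangular Hom-bialgebra. -/
def IsQuasitriangular (μ : H ⊗[k] H →ₗ[k] H) (Δ : H →ₗ[k] H ⊗[k] H) (α : H →ₗ[k] H)
    (R : H ⊗[k] H) : Prop :=
  IsHomBialgebra k μ Δ α ∧
  TensorProduct.map Δ α R
    = TensorProduct.map (TensorProduct.map α α) μ (ttc k H H H H (R ⊗ₜ[k] R)) ∧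
  TensorProduct.map α Δ R
    = TensorProduct.map μ (TensorProduct.map α α ∘ₗ (TensorProduct.comm k H H).toLinearMap)
        (ttc k H H H H (R ⊗ₜ[k] R)) ∧
  ∀ h : H, TensorProduct.map μ μ (ttc k H H H H ((TensorProduct.comm k H H (Δ h)) ⊗ₜ[k] R))
      = TensorProduct.map μ μ (ttc k H H H H (R ⊗ₜ[k] Δ h))

/-- Coaction induced by an R-matrix: `m ↦ α(R²) ⊗ R¹·m`. -/
def coactionFromR (R : H ⊗[k] H) (α : H →ₗ[k] H) (ρM : H ⊗[k] M →ₗ[k] M) :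
    M →ₗ[k] H ⊗[k] M :=
  (TensorProduct.comm k M H).toLinearMap ∘ₗ TensorProduct.map ρM α ∘ₗ rearr k H H M ∘ₗ
    TensorProduct.mk k (H ⊗[k] H) M R

/-- Quasi-braiding from an R-matrix: `m ⊗ n ↦ αN⁻¹(R²·n) ⊗ αM⁻¹(R¹·m)`. -/
def braidR (R : H ⊗[k] H) (ρM : H ⊗[k] M →ₗ[k] M) (ρN : H ⊗[k] N →ₗ[k] N)
    (αM : M ≃ₗ[k] M) (αN : N ≃ₗ[k] N) : M ⊗[k] N →ₗ[k] N ⊗[k] M :=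
  TensorProduct.map αN.symm.toLinearMap αM.symm.toLinearMap ∘ₗ
    (TensorProduct.comm k M N).toLinearMap ∘ₗ TensorProduct.map ρM ρN ∘ₗ
      ttc k H H M N ∘ₗ TensorProduct.mk k (H ⊗[k] H) (M ⊗[k] N) R

/-- Coquasitriangular Hom-bialgebra. -/
def IsCoquasitriangular (μ : H ⊗[k] H →ₗ[k] H) (Δ : H →ₗ[k] H ⊗[k] H) (α : H →ₗ[k] H)
    (σ : H ⊗[k] H →ₗ[k] k) : Prop :=
  IsHomBialgebra k μ Δ α ∧
  (∀ x y z : H, σ (μ (x ⊗ₜ[k] y) ⊗ₜ[k] α z)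
      = LinearMap.mul' k k
          (TensorProduct.map σ σ (ttc k H H H H ((α x ⊗ₜ[k] α y) ⊗ₜ[k] Δ z)))) ∧
  (∀ x y z : H, σ (α x ⊗ₜ[k] μ (y ⊗ₜ[k] z))
      = LinearMap.mul' k k
          (TensorProduct.map σ σ (ttc k H H H H (Δ x ⊗ₜ[k] (α z ⊗ₜ[k] α y))))) ∧
  (∀ x y : H,
      (TensorProduct.rid k H)
        (TensorProduct.map (μ ∘ₗ (TensorProduct.comm k H H).toLinearMap) σ
          (ttc k H H H H (Δ x ⊗ₜ[k] Δ y)))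
      = (TensorProduct.lid k H)
          (TensorProduct.map σ μ (ttc k H H H H (Δ x ⊗ₜ[k] Δ y))))

/-- Action induced by a coquasitriangular form: `h ⊗ m ↦ σ(m₍₋₁₎ ⊗ α(h)) • m₍₀₎`. -/
def actionFromSigma (σ : H ⊗[k] H →ₗ[k] k) (α : H →ₗ[k] H)
    (lM : M →ₗ[k] H ⊗[k] M) : H ⊗[k] M →ₗ[k] M :=
  (TensorProduct.lid k M).toLinearMap ∘ₗ
    TensorProduct.map (σ ∘ₗ TensorProduct.map LinearMap.id α ∘ₗ
        (TensorProduct.comm k H H).toLinearMap) LinearMap.id ∘ₗ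
      (TensorProduct.assoc k H H M).symm.toLinearMap ∘ₗ
        TensorProduct.map LinearMap.id lM

/-- Quasi-braiding from a coquasitriangular form:
`m ⊗ n ↦ σ(n₍₋₁₎ ⊗ m₍₋₁₎) • (αN⁻¹(n₍₀₎) ⊗ αM⁻¹(m₍₀₎))`. -/
def braidSigma (σ : H ⊗[k] H →ₗ[k] k)
    (lM : M →ₗ[k] H ⊗[k] M) (lN : N →ₗ[k] H ⊗[k] N)
    (αM : M ≃ₗ[k] M) (αN : N ≃ₗ[k] N) : M ⊗[k] N →ₗ[k] N ⊗[k] M :=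
  (TensorProduct.lid k (N ⊗[k] M)).toLinearMap ∘ₗ
    TensorProduct.map (σ ∘ₗ (TensorProduct.comm k H H).toLinearMap)
      (TensorProduct.map αN.symm.toLinearMap αM.symm.toLinearMap ∘ₗ
        (TensorProduct.comm k M N).toLinearMap) ∘ₗ
      ttc k H M H N ∘ₗ TensorProduct.map lM lN


section

variable {k}

theorem hatAction_tmul (Δ : H →ₗ[k] H ⊗[k] H) (ρM : H ⊗[k] M →ₗ[k] M) (ρN : H ⊗[k] N →ₗ[k] N)
    (h : H) (m : M) (n : N) :
    hatAction k Δ ρM ρN (h ⊗ₜ[k] (m ⊗ₜ[k] n))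
      = TensorProduct.map (ρM ∘ₗ (TensorProduct.mk k H M).flip m)
          (ρN ∘ₗ (TensorProduct.mk k H N).flip n) (Δ h) := by
  simp only [hatAction, ttc, LinearMap.comp_apply, TensorProduct.map_tmul, LinearMap.id_apply]
  induction Δ h with
  | zero => simp
  | tmul a b => simp
  | add x y hx hy => simp only [add_tmul, map_add, hx, hy]

theorem hatCoaction_tmul (μ : H ⊗[k] H →ₗ[k] H) (β : H →ₗ[k] H)
    (lM : M →ₗ[k] H ⊗[k] M) (lN : N →ₗ[k] H ⊗[k] N) (m : M) (n : N) :
    hatCoaction k μ β lM lN (m ⊗ₜ[k] n)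
      = TensorProduct.map (β ∘ₗ β ∘ₗ μ) LinearMap.id (ttc k H M H N (lM m ⊗ₜ[k] lN n)) :=
  rfl

theorem aYD_tmul {X Y Z : Type*} [AddCommGroup X] [Module k X] [AddCommGroup Y] [Module k Y]
    [AddCommGroup Z] [Module k Z] (αX : X ≃ₗ[k] X) (αZ : Z ≃ₗ[k] Z) (x : X) (y : Y) (z : Z) :
    aYD k αX Y αZ ((x ⊗ₜ[k] y) ⊗ₜ[k] z) = αX.symm x ⊗ₜ[k] (y ⊗ₜ[k] αZ z) :=
  rfl

theorem aYD_bijective {X Y Z : Type*} [AddCommGroup X] [Module k X] [AddCommGroup Y] [Module k Y]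
    [AddCommGroup Z] [Module k Z] (αX : X ≃ₗ[k] X) (αZ : Z ≃ₗ[k] Z) :
    Function.Bijective (aYD k αX Y αZ) :=
  (TensorProduct.congr (TensorProduct.congr αX.symm (LinearEquiv.refl k Y)) αZ ≪≫ₗ
    TensorProduct.assoc k X Y Z).bijective

theorem IsHomModule.symm_str_compat {μ : H ⊗[k] H →ₗ[k] H} {αH : H ≃ₗ[k] H}
    {ρ : H ⊗[k] M →ₗ[k] M} {αM : M ≃ₗ[k] M}
    (hM : IsHomModule k μ αH.toLinearMap ρ αM.toLinearMap) (h : H) (m : M) :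
    αM.symm (ρ (αH h ⊗ₜ[k] m)) = ρ (h ⊗ₜ[k] αM.symm m) := by
  rw [LinearEquiv.symm_apply_eq]
  simpa using (hM.str_compat h (αM.symm m)).symm

theorem IsHomComodule.coact_symm {Δ : H →ₗ[k] H ⊗[k] H} {αH : H ≃ₗ[k] H}
    {lM : M →ₗ[k] H ⊗[k] M} {αM : M ≃ₗ[k] M}
    (hM : IsHomComodule k Δ αH.toLinearMap lM αM.toLinearMap) (m : M) :
    lM (αM.symm m)
      = TensorProduct.map αH.symm.toLinearMap αM.symm.toLinearMap (lM m) := by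
  have h := LinearMap.congr_fun hM.str_compat (αM.symm m)
  simp only [LinearMap.comp_apply, LinearEquiv.coe_coe, LinearEquiv.apply_symm_apply] at h
  rw [← h, ← LinearMap.comp_apply, ← TensorProduct.map_comp]
  simp

/-- The Hom-coassociativity that makes the associator linear:
`αH⁻¹(h₁₁) ⊗ (h₁₂ ⊗ αH(h₂)) = h₁ ⊗ (h₂₁ ⊗ h₂₂)`. -/
theorem IsHomBialgebra.aYD_comul {μ : H ⊗[k] H →ₗ[k] H} {Δ : H →ₗ[k] H ⊗[k] H} {αH : H ≃ₗ[k] H}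
    (hH : IsHomBialgebra k μ Δ αH.toLinearMap) (h : H) :
    aYD k αH H αH (TensorProduct.map Δ LinearMap.id (Δ h))
      = TensorProduct.map LinearMap.id Δ (Δ h) := by
  have e := congrArg (TensorProduct.map αH.symm.toLinearMap LinearMap.id)
    (LinearMap.congr_fun hH.hom_coassoc h)
  simp only [LinearMap.comp_apply] at e
  rw [← LinearMap.comp_apply (TensorProduct.map _ _) (TensorProduct.map _ Δ),
    ← TensorProduct.map_comp] at e
  simp only [LinearEquiv.symm_comp, LinearMap.id_comp] at e
  rw [← e]
  induction Δ h with
  | zero => simp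
  | add x y hx hy => simp only [map_add, hx, hy]
  | tmul a b =>
    simp only [TensorProduct.map_tmul, LinearMap.id_apply]
    induction Δ a with
    | zero => simp
    | add x y hx hy => simp only [add_tmul, map_add, hx, hy]
    | tmul c d => simp [aYD_tmul]

theorem IsHomBialgebra.symm_mul {μ : H ⊗[k] H →ₗ[k] H} {Δ : H →ₗ[k] H ⊗[k] H} {αH : H ≃ₗ[k] H}
    (hH : IsHomBialgebra k μ Δ αH.toLinearMap) (a b : H) :
    αH.symm (μ (a ⊗ₜ[k] b)) = μ (αH.symm a ⊗ₜ[k] αH.symm b) := by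
  rw [LinearEquiv.symm_apply_eq]
  simpa using (hH.mul_mult (αH.symm a) (αH.symm b)).symm

/-- `αH⁻²(a b) c = αH⁻¹(a) αH⁻²(b αH(c))`. -/
theorem IsHomBialgebra.symm_hom_assoc {μ : H ⊗[k] H →ₗ[k] H} {Δ : H →ₗ[k] H ⊗[k] H}
    {αH : H ≃ₗ[k] H} (hH : IsHomBialgebra k μ Δ αH.toLinearMap) (a b c : H) :
    μ (αH.symm (αH.symm (μ (a ⊗ₜ[k] b))) ⊗ₜ[k] c)
      = μ (αH.symm a ⊗ₜ[k] αH.symm (αH.symm (μ (b ⊗ₜ[k] αH c)))) := by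
  have e := hH.hom_assoc (αH.symm (αH.symm a)) (αH.symm (αH.symm b)) (αH.symm c)
  simp only [LinearEquiv.coe_coe, LinearEquiv.apply_symm_apply] at e
  simp only [hH.symm_mul, LinearEquiv.symm_apply_apply]
  exact e.symm

end

/-- the associator `a_{M,N,P}((m⊗n)⊗p) = αM⁻¹(m) ⊗ (n ⊗ αP(p))` is a bijective
morphism of left H-modules and left H-comodules between the iterated ⊗̂ products. -/
theorem stmt4 {k H M N P : Type*} [Field k]
    [AddCommGroup H] [Module k H] [AddCommGroup M] [Module k M]
    [AddCommGroup N] [Module k N] [AddCommGroup P] [Module k P]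
    (μ : H ⊗[k] H →ₗ[k] H) (Δ : H →ₗ[k] H ⊗[k] H) (αH : H ≃ₗ[k] H)
    (hH : IsHomBialgebra k μ Δ αH.toLinearMap)
    (ρM : H ⊗[k] M →ₗ[k] M) (lM : M →ₗ[k] H ⊗[k] M) (αM : M ≃ₗ[k] M)
    (hM : IsYetterDrinfeld k μ Δ αH.toLinearMap ρM lM αM.toLinearMap)
    (ρN : H ⊗[k] N →ₗ[k] N) (lN : N →ₗ[k] H ⊗[k] N) (αN : N ≃ₗ[k] N)
    (hN : IsYetterDrinfeld k μ Δ αH.toLinearMap ρN lN αN.toLinearMap)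
    (ρP : H ⊗[k] P →ₗ[k] P) (lP : P →ₗ[k] H ⊗[k] P) (αP : P ≃ₗ[k] P)
    (hP : IsYetterDrinfeld k μ Δ αH.toLinearMap ρP lP αP.toLinearMap) :
    Function.Bijective (aYD k αM N αP) ∧
    (TensorProduct.map αM.toLinearMap (TensorProduct.map αN.toLinearMap αP.toLinearMap) ∘ₗ
        aYD k αM N αP
      = aYD k αM N αP ∘ₗ
          TensorProduct.map (TensorProduct.map αM.toLinearMap αN.toLinearMap) αP.toLinearMap) ∧
    (aYD k αM N αP ∘ₗ hatAction k Δ (hatAction k Δ ρM ρN) ρP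
      = hatAction k Δ ρM (hatAction k Δ ρN ρP) ∘ₗ
          TensorProduct.map (LinearMap.id : H →ₗ[k] H) (aYD k αM N αP)) ∧
    (TensorProduct.map (LinearMap.id : H →ₗ[k] H) (aYD k αM N αP) ∘ₗ
        hatCoaction k μ αH.symm.toLinearMap (hatCoaction k μ αH.symm.toLinearMap lM lN) lP
      = hatCoaction k μ αH.symm.toLinearMap lM (hatCoaction k μ αH.symm.toLinearMap lN lP) ∘ₗ
          aYD k αM N αP) := by
  refine ⟨aYD_bijective αM αP, ?_, ?_, ?_⟩
  · ext m n p
    simp [aYD_tmul]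
  · ext h m n p
    simp only [TensorProduct.AlgebraTensorModule.curry_apply, TensorProduct.curry_apply,
      LinearMap.restrictScalars_self, LinearMap.comp_apply, TensorProduct.map_tmul,
      LinearMap.id_apply, aYD_tmul, hatAction_tmul]
    have left (t : H ⊗[k] H) :
        aYD k αM N αP (TensorProduct.map
            (hatAction k Δ ρM ρN ∘ₗ (TensorProduct.mk k H (M ⊗[k] N)).flip (m ⊗ₜ[k] n))
            (ρP ∘ₗ (TensorProduct.mk k H P).flip p) t)
          = TensorProduct.map (ρM ∘ₗ (TensorProduct.mk k H M).flip (αM.symm m))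
              (TensorProduct.map (ρN ∘ₗ (TensorProduct.mk k H N).flip n)
                (ρP ∘ₗ (TensorProduct.mk k H P).flip (αP p)))
              (aYD k αH H αH (TensorProduct.map Δ LinearMap.id t)) := by
      induction t with
      | zero => simp
      | add x y hx hy => simp only [map_add, hx, hy]
      | tmul a b =>
        simp only [TensorProduct.map_tmul, LinearMap.id_apply, LinearMap.comp_apply,
          LinearMap.flip_apply, TensorProduct.mk_apply, hatAction_tmul]
        induction Δ a with
        | zero => simp
        | add x y hx hy => simp only [add_tmul, map_add, hx, hy]
        | tmul c d =>
          obtain ⟨c, rfl⟩ := αH.surjective c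
          have e := hP.1.str_compat b p
          simp only [LinearEquiv.coe_coe] at e
          simp [aYD_tmul, hM.1.symm_str_compat, e]
    rw [left, hH.aYD_comul]
    induction Δ h with
    | zero => simp
    | add x y hx hy => simp only [map_add, hx, hy]
    | tmul a b => simp [hatAction_tmul]
  · ext m n p
    have e := LinearMap.congr_fun hP.2.1.str_compat p
    simp only [LinearMap.comp_apply, LinearEquiv.coe_coe] at e
    simp only [TensorProduct.AlgebraTensorModule.curry_apply, TensorProduct.curry_apply,
      LinearMap.restrictScalars_self, LinearMap.comp_apply,
      aYD_tmul, hatCoaction_tmul, hM.2.1.coact_symm, ← e]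
    generalize lM m = t, lN n = u, lP p = v
    induction t with
    | zero => simp
    | add x y hx hy => simp only [add_tmul, map_add, hx, hy]
    | tmul a m =>
      induction u with
      | zero => simp
      | add x y hx hy => simp only [add_tmul, tmul_add, map_add, hx, hy]
      | tmul b n =>
        induction v with
        | zero => simp
        | add x y hx hy => simp only [tmul_add, map_add, hx, hy]
        | tmul c p => simp [ttc, aYD_tmul, hH.symm_hom_assoc]

end HomYD
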